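/- arXiv:1205.0907 — 3 statements merged into one kernel-verified Lean document; each statement's English description precedes it below -/
import Mathlib

section
/- Suppose A ∈ C¹(ℝ) with A' > 0 and f ∈ C¹(ℝ). Let u = u(y,s) be a classical (twice continuously differentiable) solution of ∂_s u + ∂_y f(u) = ∂_y² A(u). Then for every constant c ∈ ℝ and every ε > 0: ∂_s ψ_ε(u,c) + ∂_y q_ε(u,c) − ∂_y² |A(u) − A(c)|_ε = − ∂_y(sign_ε(A(u) − A(c))) · ∂_y A(u). -/
open MeasureTheory

/-- The Lipschitz approximation of the sign function. -/
noncomputable def signe (ε σ : ℝ) : ℝ :=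
  if |σ| < ε then Real.sin (Real.pi * σ / (2 * ε)) else Real.sign σ

/-- The corresponding approximation `|u|_ε = ∫₀ᵘ sign_ε(z) dz` of the absolute value. -/
noncomputable def abse (ε u : ℝ) : ℝ := ∫ z in (0:ℝ)..u, signe ε z

/-- The entropy `ψ_ε(u,c) = ∫_c^u sign_ε(A(z) − A(c)) dz`. -/
noncomputable def psie (A : ℝ → ℝ) (ε u c : ℝ) : ℝ :=
  ∫ z in c..u, signe ε (A z - A c)

/-- The entropy flux `q_ε(u,c) = ∫_c^u sign_ε(A(z) − A(c)) f'(z) dz`. -/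
noncomputable def qe (A f : ℝ → ℝ) (ε u c : ℝ) : ℝ :=
  ∫ z in c..u, signe ε (A z - A c) * deriv f z

lemma signe_of_le {ε σ : ℝ} (hε : 0 < ε) (h : |σ| ≤ ε) :
    signe ε σ = Real.sin (Real.pi * σ / (2 * ε)) := by
  unfold signe
  split_ifs with h1
  · rfl
  · have h2 : |σ| = ε := le_antisymm h (not_lt.1 h1)
    rcases (abs_eq hε.le).1 h2 with rfl | rfl
    · rw [Real.sign_of_pos hε, show Real.pi * σ / (2 * σ) = Real.pi / 2 by field_simp,
        Real.sin_pi_div_two]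
    · rw [Real.sign_of_neg (by linarith),
        show Real.pi * -ε / (2 * ε) = -(Real.pi / 2) by field_simp,
        Real.sin_neg, Real.sin_pi_div_two]

lemma signe_of_ge {ε σ : ℝ} (hε : 0 < ε) (h : ε ≤ σ) : signe ε σ = 1 := by
  unfold signe
  rw [if_neg (not_lt.2 (h.trans (le_abs_self σ))), Real.sign_of_pos (hε.trans_le h)]

lemma signe_neg (ε σ : ℝ) : signe ε (-σ) = -signe ε σ := by
  unfold signe
  rw [abs_neg]
  split_ifs
  · rw [← Real.sin_neg]
    congr 1
    ring
  · exact Real.sign_neg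

lemma hasDerivAt_sin_rescaled (ε σ : ℝ) :
    HasDerivAt (fun x => Real.sin (Real.pi * x / (2 * ε)))
      (Real.cos (Real.pi * σ / (2 * ε)) * (Real.pi * 1 / (2 * ε))) σ :=
  (((hasDerivAt_id σ).const_mul Real.pi).div_const (2 * ε)).sin

lemma differentiableAt_signe_of_nonneg {ε σ : ℝ} (hε : 0 < ε) (hσ : 0 ≤ σ) :
    DifferentiableAt ℝ (signe ε) σ := by
  rcases lt_trichotomy σ ε with h | rfl | h
  · refine (hasDerivAt_sin_rescaled ε σ).differentiableAt.congr_of_eventuallyEq ?_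
    filter_upwards [Ioo_mem_nhds (show -ε < σ by linarith) h] with x hx
    exact signe_of_le hε (abs_le.2 ⟨hx.1.le, hx.2.le⟩)
  · have hl : HasDerivWithinAt (signe σ) 0 (Set.Iic σ) σ := by
      have h0 := hasDerivAt_sin_rescaled σ σ
      rw [show Real.pi * σ / (2 * σ) = Real.pi / 2 by field_simp, Real.cos_pi_div_two,
        zero_mul] at h0
      refine h0.hasDerivWithinAt.congr_of_eventuallyEq ?_
        (signe_of_le hε (abs_of_pos hε).le)
      filter_upwards [self_mem_nhdsWithin,
        mem_nhdsWithin_of_mem_nhds (Ioi_mem_nhds (show -σ < σ by linarith))] with x hx hx'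
      exact signe_of_le hε (abs_le.2 ⟨(Set.mem_Ioi.1 hx').le, hx⟩)
    have hr : HasDerivWithinAt (signe σ) 0 (Set.Ici σ) σ :=
      (hasDerivWithinAt_const σ _ (1 : ℝ)).congr (fun x hx => signe_of_ge hε hx)
        (signe_of_ge hε le_rfl)
    have := hl.union hr
    rw [Set.Iic_union_Ici, hasDerivWithinAt_univ] at this
    exact this.differentiableAt
  · refine (differentiableAt_const (1 : ℝ)).congr_of_eventuallyEq ?_
    filter_upwards [Ioi_mem_nhds h] with x hx
    exact signe_of_ge hε (le_of_lt hx)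

lemma differentiable_signe {ε : ℝ} (hε : 0 < ε) : Differentiable ℝ (signe ε) := by
  intro σ
  rcases le_total 0 σ with h | h
  · exact differentiableAt_signe_of_nonneg hε h
  · have h1 : DifferentiableAt ℝ (fun x => -signe ε (-x)) σ :=
      ((differentiableAt_signe_of_nonneg hε (neg_nonneg.2 h)).comp σ
        differentiableAt_id.neg).neg
    refine h1.congr_of_eventuallyEq (Filter.Eventually.of_forall fun x => ?_)
    simp only [signe_neg, neg_neg]

lemma hasDerivAt_abse {ε : ℝ} (hε : 0 < ε) (v : ℝ) : HasDerivAt (abse ε) (signe ε v) v :=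
  (differentiable_signe hε).continuous.integral_hasStrictDerivAt 0 v |>.hasDerivAt

lemma hasDerivAt_psie {A : ℝ → ℝ} (hA : Continuous A) {ε : ℝ} (hε : 0 < ε) (v c : ℝ) :
    HasDerivAt (fun v => psie A ε v c) (signe ε (A v - A c)) v := by
  have h : Continuous fun z => signe ε (A z - A c) :=
    (differentiable_signe hε).continuous.comp (hA.sub continuous_const)
  exact (h.integral_hasStrictDerivAt c v).hasDerivAt

lemma hasDerivAt_qe {A f : ℝ → ℝ} (hA : Continuous A) (hf : Continuous (deriv f)) {ε : ℝ}
    (hε : 0 < ε) (v c : ℝ) :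
    HasDerivAt (fun v => qe A f ε v c) (signe ε (A v - A c) * deriv f v) v := by
  have h : Continuous fun z => signe ε (A z - A c) * deriv f z :=
    ((differentiable_signe hε).continuous.comp (hA.sub continuous_const)).mul hf
  exact (h.integral_hasStrictDerivAt c v).hasDerivAt

/-- the entropy identity for a classical solution of
`∂_s u + ∂_y f(u) = ∂_y² A(u)` when `A' > 0`. -/
theorem stmt_6
    (f A : ℝ → ℝ) (hf : ContDiff ℝ 1 f) (hA : ContDiff ℝ 1 A)
    (hA' : ∀ z, 0 < deriv A z)
    (u : ℝ → ℝ → ℝ)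
    (hu : ContDiff ℝ 2 (fun p : ℝ × ℝ => u p.1 p.2))
    (hAu : ∀ s, Differentiable ℝ (fun y => deriv (fun y' => A (u y' s)) y))
    (hPDE : ∀ y s, deriv (fun s' => u y s') s + deriv (fun y' => f (u y' s)) y
        = deriv (fun y' => deriv (fun y'' => A (u y'' s)) y') y)
    (ε : ℝ) (hε : 0 < ε) :
    ∀ (c : ℝ) (y s : ℝ),
      deriv (fun s' => psie A ε (u y s') c) s
        + deriv (fun y' => qe A f ε (u y' s) c) y
        - deriv (fun y' => deriv (fun y'' => abse ε (A (u y'' s) - A c)) y') y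
      = - deriv (fun y' => signe ε (A (u y' s) - A c)) y
          * deriv (fun y' => A (u y' s)) y := by
  intro c y s
  have hud := hu.differentiable (by norm_num)
  have hfd := hf.differentiable (by norm_num)
  have hf' : Continuous (deriv f) := hf.continuous_deriv le_rfl
  have hAd := hA.differentiable (by norm_num)
  have huy : Differentiable ℝ fun y' => u y' s :=
    hud.comp (differentiable_id.prodMk (differentiable_const s))
  have hus : Differentiable ℝ fun s' => u y s' :=
    hud.comp ((differentiable_const y).prodMk differentiable_id)
  have ha : Differentiable ℝ fun y' => A (u y' s) := hAd.comp huy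
  have hS : Differentiable ℝ fun y' => signe ε (A (u y' s) - A c) :=
    (differentiable_signe hε).comp (ha.sub_const _)
  have hψ : deriv (fun s' => psie A ε (u y s') c) s
      = signe ε (A (u y s) - A c) * deriv (fun s' => u y s') s :=
    ((hasDerivAt_psie hA.continuous hε (u y s) c).comp s (hus s).hasDerivAt).deriv
  have hq : deriv (fun y' => qe A f ε (u y' s) c) y
      = signe ε (A (u y s) - A c) * deriv f (u y s) * deriv (fun y' => u y' s) y := by
    have h := hasDerivAt_qe hA.continuous hf' hε (u y s) c
    exact (h.comp y (huy y).hasDerivAt).deriv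
  have hfu : deriv (fun y' => f (u y' s)) y
      = deriv f (u y s) * deriv (fun y' => u y' s) y :=
    ((hfd (u y s)).hasDerivAt.comp y (huy y).hasDerivAt).deriv
  have habs : (fun y' => deriv (fun y'' => abse ε (A (u y'' s) - A c)) y')
      = fun y' => signe ε (A (u y' s) - A c) * deriv (fun y'' => A (u y'' s)) y' := by
    funext y'
    exact ((hasDerivAt_abse hε (A (u y' s) - A c)).comp y'
      ((ha y').hasDerivAt.sub_const (A c))).deriv
  have habs2 : deriv (fun y' => signe ε (A (u y' s) - A c) * deriv (fun y'' => A (u y'' s)) y') y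
      = deriv (fun y' => signe ε (A (u y' s) - A c)) y * deriv (fun y'' => A (u y'' s)) y
        + signe ε (A (u y s) - A c) * deriv (fun y' => deriv (fun y'' => A (u y'' s)) y') y :=
    ((hS y).hasDerivAt.mul (hAu s y).hasDerivAt).deriv
  rw [hψ, hq, habs, habs2, ← hPDE y s, hfu]
  ring
end

section
/- With u_Δx the piecewise constant semi-discrete approximation, u the classical solution, and φ the test function described in the context, one has |∬_{Π_T²} sign(u_Δx − u)(f(u_Δx) − f(u))(D_+φ + ∂_y φ) dX| ≤ C (Δx/r)(1 + Δx/r), where C depends only on T, ρ, the Lipschitz constant of f, and |u⁰|_{BV(ℝ)}, but not on Δx, r, r₀, α. -/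
open MeasureTheory Set Filter

/-- The scaled mollifier `ω_r(x) = ρ(x/r)/r`. -/
noncomputable def moll (ρ : ℝ → ℝ) (r x : ℝ) : ℝ := ρ (x / r) / r

/-- `H_α(t) = ∫_{-∞}^t ρ_α(ξ) dξ`. -/
noncomputable def Hmoll (ρ : ℝ → ℝ) (α t : ℝ) : ℝ := ∫ ξ in Set.Iic t, moll ρ α ξ

/-- The test function
`φ(x,t,y,s) = (H_α(t−ν) − H_α(t−τ)) ω_r(x−y) ρ_{r₀}(t−s)`. -/
noncomputable def testphi (ρ : ℝ → ℝ) (r r₀ α ν τ x t y s : ℝ) : ℝ :=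
  (Hmoll ρ α (t - ν) - Hmoll ρ α (t - τ)) * moll ρ r (x - y) * moll ρ r₀ (t - s)

/-- The Kruzkov flux is Lipschitz in its second argument. -/
lemma abs_sign_mul_sub_sub_le {f : ℝ → ℝ} {L : NNReal} (hf : LipschitzWith L f) (a b c : ℝ) :
    |Real.sign (a - b) * (f a - f b) - Real.sign (a - c) * (f a - f c)| ≤ L * |b - c| := by
  have h : ∀ x y : ℝ, |f x - f y| ≤ L * |x - y| := fun x y => by
    simpa [Real.dist_eq] using hf.dist_le_mul x y
  have hab := abs_le.1 (h a b)
  have hac := abs_le.1 (h a c)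
  have hbc := abs_le.1 (h b c)
  have hL : (0 : ℝ) ≤ L := L.2
  rcases lt_trichotomy a b with h1 | rfl | h1 <;> rcases lt_trichotomy a c with h2 | rfl | h2
  · rw [Real.sign_of_neg (sub_neg.2 h1), Real.sign_of_neg (sub_neg.2 h2)]
    exact abs_le.2 ⟨by linarith, by linarith⟩
  · rw [Real.sign_of_neg (sub_neg.2 h1)]
    exact abs_le.2 ⟨by linarith, by linarith⟩
  · rw [Real.sign_of_neg (sub_neg.2 h1), Real.sign_of_pos (sub_pos.2 h2)]
    rw [abs_of_neg (sub_neg.2 h1)] at hab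
    rw [abs_of_pos (sub_pos.2 h2)] at hac
    rw [abs_of_pos (by linarith : 0 < b - c)]
    exact abs_le.2 ⟨by linarith, by linarith⟩
  · rw [Real.sign_of_neg (sub_neg.2 h2)]
    exact abs_le.2 ⟨by linarith, by linarith⟩
  · simp
  · rw [Real.sign_of_pos (sub_pos.2 h2)]
    exact abs_le.2 ⟨by linarith, by linarith⟩
  · rw [Real.sign_of_pos (sub_pos.2 h1), Real.sign_of_neg (sub_neg.2 h2)]
    rw [abs_of_pos (sub_pos.2 h1)] at hab
    rw [abs_of_neg (sub_neg.2 h2)] at hac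
    rw [abs_of_neg (by linarith : b - c < 0)]
    exact abs_le.2 ⟨by linarith, by linarith⟩
  · rw [Real.sign_of_pos (sub_pos.2 h1)]
    exact abs_le.2 ⟨by linarith, by linarith⟩
  · rw [Real.sign_of_pos (sub_pos.2 h1), Real.sign_of_pos (sub_pos.2 h2)]
    exact abs_le.2 ⟨by linarith, by linarith⟩

/-- The increments over a bi-infinite arithmetic progression are controlled by the variation. -/
lemma tsum_edist_add_zsmul_le_eVariationOn (w : ℝ → ℝ) {z : ℝ} (hz : 0 < z) (y : ℝ) :
    ∑' n : ℤ, edist (w (y + n * z + z)) (w (y + n * z)) ≤ eVariationOn w univ := by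
  rw [ENNReal.tsum_eq_iSup_sum]
  refine iSup_le fun s => ?_
  obtain ⟨N, hN⟩ : ∃ N : ℕ, ∀ n ∈ s, -(N : ℤ) ≤ n ∧ n < N := by
    refine ⟨s.sup Int.natAbs + 1, fun n hn => ?_⟩
    have := Finset.le_sup (f := Int.natAbs) hn
    omega
  let p : ℕ → ℝ := fun i => y + ((i : ℝ) - N) * z
  have hp : Monotone p := fun i j hij => by
    have : (i : ℝ) ≤ j := by exact_mod_cast hij
    simp only [p]
    gcongr
  refine le_trans ?_ (eVariationOn.sum_le (f := w) (n := 2 * N) hp fun _ => mem_univ _)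
  calc ∑ n ∈ s, edist (w (y + n * z + z)) (w (y + n * z))
      ≤ ∑ n ∈ (Finset.range (2 * N)).image (fun i : ℕ => (i : ℤ) - N),
          edist (w (y + n * z + z)) (w (y + n * z)) := by
        refine Finset.sum_le_sum_of_subset fun n hn => ?_
        have := hN n hn
        exact Finset.mem_image.2 ⟨(n + N).toNat, Finset.mem_range.2 (by omega), by omega⟩
    _ = ∑ i ∈ Finset.range (2 * N), edist (w (p (i + 1))) (w (p i)) := by
        rw [Finset.sum_image (fun i _ j _ h => by simpa using h)]
        refine Finset.sum_congr rfl fun i _ => ?_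
        congr 2 <;> (simp only [p]; push_cast; ring)

lemma lintegral_translate_sub_le_of_pos {w : ℝ → ℝ} (hw : Measurable w) {z : ℝ} (hz : 0 < z) :
    ∫⁻ y, ‖w (y + z) - w y‖ₑ ≤ ENNReal.ofReal z * eVariationOn w univ := by
  have hm : ∀ c : ℝ, Measurable fun y => edist (w (y + c + z)) (w (y + c)) := fun c =>
    (hw.comp (by fun_prop)).edist (hw.comp (by fun_prop))
  have hshift : ∀ n : ℤ, ∫⁻ y in Ioc (0 + n • z) (0 + (n + 1) • z), edist (w (y + z)) (w y)
      = ∫⁻ y in Ioc 0 z, edist (w (y + n * z + z)) (w (y + n * z)) := fun n => by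
    rw [← lintegral_indicator measurableSet_Ioc, ← lintegral_indicator measurableSet_Ioc,
      ← lintegral_add_right_eq_self _ ((n : ℝ) * z)]
    refine lintegral_congr fun y => ?_
    have : (y + n * z ∈ Ioc (0 + n • z) (0 + (n + 1) • z)) ↔ y ∈ Ioc 0 z := by
      simp only [mem_Ioc, zsmul_eq_mul, Int.cast_add, Int.cast_one]
      constructor <;> rintro ⟨h1, h2⟩ <;> constructor <;> linarith
    simp only [indicator, this]
  calc ∫⁻ y, ‖w (y + z) - w y‖ₑ
      = ∫⁻ y in ⋃ n : ℤ, Ioc (0 + n • z) (0 + (n + 1) • z), edist (w (y + z)) (w y) := by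
        rw [iUnion_Ioc_add_zsmul hz, setLIntegral_univ]
        simp only [edist_eq_enorm_sub]
    _ = ∑' n : ℤ, ∫⁻ y in Ioc 0 z, edist (w (y + n * z + z)) (w (y + n * z)) := by
        rw [lintegral_iUnion (fun _ => measurableSet_Ioc) (pairwise_disjoint_Ioc_add_zsmul 0 z)]
        exact tsum_congr hshift
    _ = ∫⁻ y in Ioc 0 z, ∑' n : ℤ, edist (w (y + n * z + z)) (w (y + n * z)) :=
        (lintegral_tsum fun n => (hm _).aemeasurable).symm
    _ ≤ ∫⁻ _ in Ioc 0 z, eVariationOn w univ :=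
        lintegral_mono fun y => tsum_edist_add_zsmul_le_eVariationOn w hz y
    _ = ENNReal.ofReal z * eVariationOn w univ := by
        rw [setLIntegral_const, Real.volume_Ioc, sub_zero, mul_comm]

/-- The `L¹` modulus of continuity of a function of bounded variation is linear. -/
lemma lintegral_translate_sub_le {w : ℝ → ℝ} (hw : Measurable w) (z : ℝ) :
    ∫⁻ y, ‖w (y + z) - w y‖ₑ ≤ ENNReal.ofReal |z| * eVariationOn w univ := by
  rcases lt_trichotomy z 0 with hz | rfl | hz
  · rw [abs_of_neg hz]
    refine le_trans (le_of_eq ?_) (lintegral_translate_sub_le_of_pos hw (neg_pos.2 hz))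
    rw [← lintegral_add_right_eq_self _ (-z)]
    refine lintegral_congr fun y => ?_
    rw [neg_add_cancel_right, ← enorm_neg, neg_sub]
  · simp
  · rw [abs_of_pos hz]
    exact lintegral_translate_sub_le_of_pos hw hz

/-- Young-type bound: averaging the increments of `w` against a kernel `k`. -/
lemma lintegral_lintegral_sub_mul_kernel_le {w k : ℝ → ℝ} (hw : Measurable w)
    (hk : Measurable k) :
    ∫⁻ x, ∫⁻ y, ‖w y - w x‖ₑ * ‖k (x - y)‖ₑ
      ≤ (∫⁻ z, ‖k z‖ₑ * ENNReal.ofReal |z|) * eVariationOn w univ := by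
  have hm1 : Measurable fun p : ℝ × ℝ => ‖w p.2 - w p.1‖ₑ * ‖k (p.1 - p.2)‖ₑ := by fun_prop
  have hm2 : Measurable fun p : ℝ × ℝ => ‖w p.1 - w (p.2 + p.1)‖ₑ * ‖k p.2‖ₑ := by fun_prop
  calc ∫⁻ x, ∫⁻ y, ‖w y - w x‖ₑ * ‖k (x - y)‖ₑ
      = ∫⁻ y, ∫⁻ x, ‖w y - w x‖ₑ * ‖k (x - y)‖ₑ := lintegral_lintegral_swap hm1.aemeasurable
    _ = ∫⁻ y, ∫⁻ z, ‖w y - w (z + y)‖ₑ * ‖k z‖ₑ := by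
        refine lintegral_congr fun y => ?_
        rw [← lintegral_add_right_eq_self _ y]
        simp only [add_sub_cancel_right]
    _ = ∫⁻ z, ∫⁻ y, ‖w y - w (z + y)‖ₑ * ‖k z‖ₑ := lintegral_lintegral_swap hm2.aemeasurable
    _ ≤ ∫⁻ z, ‖k z‖ₑ * ENNReal.ofReal |z| * eVariationOn w univ := by
        refine lintegral_mono fun z => ?_
        rw [lintegral_mul_const _ (by fun_prop), mul_comm, mul_assoc]
        gcongr
        refine le_trans (le_of_eq ?_) (lintegral_translate_sub_le hw z)
        refine lintegral_congr fun y => ?_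
        rw [← enorm_neg, neg_sub, add_comm]
    _ = _ := lintegral_mul_const _ (by fun_prop)

/-- The consistency error of the forward difference quotient of the mollifier `ω_r`. -/
noncomputable def mollDefect (ρ : ℝ → ℝ) (Δ r z : ℝ) : ℝ :=
  (moll ρ r (z + Δ) - moll ρ r z) / Δ - deriv ρ (z / r) / r ^ 2

section Kernel

variable {ρ : ℝ → ℝ} {Δ r : ℝ}

lemma hasDerivAt_moll (hρ : Differentiable ℝ ρ) (r z : ℝ) :
    HasDerivAt (moll ρ r) (deriv ρ (z / r) / r ^ 2) z := by
  have h := (((hρ (z / r)).hasDerivAt.comp z ((hasDerivAt_id z).div_const r)).div_const r)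
  refine h.congr_deriv ?_
  field_simp

lemma hasCompactSupport_moll (hc : HasCompactSupport ρ) (hr : 0 < r) :
    HasCompactSupport (moll ρ r) := by
  have h := hc.comp_homeomorph (Homeomorph.mulRight₀ r⁻¹ (inv_ne_zero hr.ne'))
  exact h.mul_right (f' := fun _ => r⁻¹)

lemma continuous_mollDefect (hρ : ContDiff ℝ 1 ρ) : Continuous (mollDefect ρ Δ r) := by
  have h1 := hρ.continuous
  have h2 := hρ.continuous_deriv le_rfl
  unfold mollDefect moll
  fun_prop

lemma hasCompactSupport_mollDefect (hρ : Differentiable ℝ ρ) (hc : HasCompactSupport ρ)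
    (hr : 0 < r) : HasCompactSupport (mollDefect ρ Δ r) := by
  have h1 := hasCompactSupport_moll hc hr
  have h2 := h1.comp_homeomorph (Homeomorph.addRight Δ)
  have h3 := h1.deriv
  have h4 := ((h2.sub h1).mul_right (f' := fun _ => Δ⁻¹)).sub h3
  have heq : mollDefect ρ Δ r
      = (moll ρ r ∘ Homeomorph.addRight Δ - moll ρ r) * (fun _ => Δ⁻¹) - deriv (moll ρ r) := by
    ext z
    simp [mollDefect, (hasDerivAt_moll hρ r z).deriv, div_eq_mul_inv]
  rw [heq]
  exact h4

lemma integral_mollDefect (hρ : ContDiff ℝ 1 ρ) (hc : HasCompactSupport ρ) (hr : 0 < r) :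
    ∫ z, mollDefect ρ Δ r z = 0 := by
  have hd := hρ.differentiable one_ne_zero
  have hcont : Continuous (moll ρ r) := by
    have := hρ.continuous
    unfold moll
    fun_prop
  have h1 := hasCompactSupport_moll hc hr
  have hi : Integrable (moll ρ r) := hcont.integrable_of_hasCompactSupport h1
  have hi2 : Integrable fun z => moll ρ r (z + Δ) := hi.comp_add_right Δ
  have hi4 : Integrable fun z => (moll ρ r (z + Δ) - moll ρ r z) / Δ := (hi2.sub hi).div_const Δ
  have hder : (fun z => deriv ρ (z / r) / r ^ 2) = deriv (moll ρ r) := by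
    ext z
    exact (hasDerivAt_moll hd r z).deriv.symm
  have hi3 : Integrable fun z => deriv ρ (z / r) / r ^ 2 := by
    refine Continuous.integrable_of_hasCompactSupport ?_ (by rw [hder]; exact h1.deriv)
    have := hρ.continuous_deriv le_rfl
    fun_prop
  unfold mollDefect
  rw [integral_sub hi4 hi3, integral_div, integral_sub hi2 hi,
    integral_add_right_eq_self (moll ρ r),
    integral_eq_zero_of_hasDerivAt_of_integrable (fun z => hasDerivAt_moll hd r z) hi3 hi]
  simp

lemma abs_mollDefect_le {M : NNReal} (hρ : Differentiable ℝ ρ)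
    (hM : LipschitzWith M (deriv ρ)) (hsupp : tsupport ρ ⊆ Icc (-1) 1) (hΔ : 0 < Δ) (hr : 0 < r)
    (z : ℝ) : |mollDefect ρ Δ r z| ≤ M * Δ / r ^ 3 *
      ((Icc (-r) r).indicator 1 z + (Icc (-r - Δ) (r - Δ)).indicator 1 z) := by
  have hz0 : ∀ x, x ∉ Icc (-r) r → x / r ∉ tsupport ρ := fun x hx h => hx <| by
    have := hsupp h
    rw [mem_Icc, le_div_iff₀ hr, div_le_iff₀ hr] at this
    constructor <;> linarith [this.1, this.2]
  have hc : 0 ≤ M * Δ / r ^ 3 := by positivity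
  by_cases h : z ∈ Icc (-r) r ∨ z ∈ Icc (-r - Δ) (r - Δ)
  · have h1 : 1 ≤ (Icc (-r) r).indicator (1 : ℝ → ℝ) z
        + (Icc (-r - Δ) (r - Δ)).indicator (1 : ℝ → ℝ) z := by
      rcases h with h | h
      · rw [indicator_of_mem h]
        have := indicator_nonneg (s := Icc (-r - Δ) (r - Δ)) (f := (1 : ℝ → ℝ))
          (fun _ _ => zero_le_one) z
        simp only [Pi.one_apply]
        linarith
      · rw [indicator_of_mem h]
        have := indicator_nonneg (s := Icc (-r) r) (f := (1 : ℝ → ℝ))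
          (fun _ _ => zero_le_one) z
        simp only [Pi.one_apply]
        linarith
    refine le_trans ?_ (le_mul_of_one_le_right hc h1)
    obtain ⟨ξ, hξ, hξ'⟩ := exists_hasDerivAt_eq_slope (moll ρ r)
      (fun x => deriv ρ (x / r) / r ^ 2) (lt_add_of_pos_right z hΔ)
      (fun x _ => (hasDerivAt_moll hρ r x).continuousAt.continuousWithinAt)
      (fun x _ => hasDerivAt_moll hρ r x)
    rw [add_sub_cancel_left] at hξ'
    have hl := hM.dist_le_mul (ξ / r) (z / r)
    rw [Real.dist_eq, Real.dist_eq, ← sub_div, abs_div, abs_of_pos hr,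
      abs_of_pos (sub_pos.2 hξ.1)] at hl
    unfold mollDefect
    rw [← hξ', ← sub_div, abs_div, abs_of_pos (by positivity : 0 < r ^ 2)]
    calc |deriv ρ (ξ / r) - deriv ρ (z / r)| / r ^ 2
        ≤ (M * (Δ / r)) / r ^ 2 := by
          gcongr
          refine hl.trans ?_
          gcongr
          linarith [hξ.2]
      _ = M * Δ / r ^ 3 := by field_simp
  · push Not at h
    have h2 : z + Δ ∉ Icc (-r) r := fun h' => h.2 ⟨by linarith [h'.1], by linarith [h'.2]⟩
    rw [indicator_of_notMem h.1, indicator_of_notMem h.2]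
    have e1 := image_eq_zero_of_notMem_tsupport (hz0 _ h.1)
    have e2 := image_eq_zero_of_notMem_tsupport (hz0 _ h2)
    have e3 : deriv ρ (z / r) = 0 :=
      image_eq_zero_of_notMem_tsupport fun h' => hz0 _ h.1 (tsupport_deriv_subset h')
    simp [mollDefect, moll, e1, e2, e3]

lemma lintegral_mollDefect_mul_abs_le {M : NNReal} (hρ : Differentiable ℝ ρ)
    (hM : LipschitzWith M (deriv ρ)) (hsupp : tsupport ρ ⊆ Icc (-1) 1) (hΔ : 0 < Δ)
    (hr : 0 < r) :
    ∫⁻ z, ‖mollDefect ρ Δ r z‖ₑ * ENNReal.ofReal |z|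
      ≤ ENNReal.ofReal (4 * M * (Δ / r) * (1 + Δ / r)) := by
  set c : ℝ := M * Δ / r ^ 3 * (r + Δ) with hc
  have hc0 : 0 ≤ c := by positivity
  calc ∫⁻ z, ‖mollDefect ρ Δ r z‖ₑ * ENNReal.ofReal |z|
      ≤ ∫⁻ z, ((Icc (-r) r).indicator (fun _ => ENNReal.ofReal c) z
          + (Icc (-r - Δ) (r - Δ)).indicator (fun _ => ENNReal.ofReal c) z) := by
        refine lintegral_mono fun z => ?_
        have hb := abs_mollDefect_le hρ hM hsupp hΔ hr z
        have hz : |z| ≤ r + Δ ∨ (z ∉ Icc (-r) r ∧ z ∉ Icc (-r - Δ) (r - Δ)) := by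
          refine or_iff_not_imp_left.2 fun h => ⟨fun h' => h ?_, fun h' => h ?_⟩ <;>
            exact abs_le.2 ⟨by linarith [h'.1], by linarith [h'.2]⟩
        rw [Real.enorm_eq_ofReal_abs, ← ENNReal.ofReal_mul (abs_nonneg _)]
        have key : |mollDefect ρ Δ r z| * |z| ≤ c *
            ((Icc (-r) r).indicator 1 z + (Icc (-r - Δ) (r - Δ)).indicator 1 z) := by
          rcases hz with hz | hz
          · calc _ ≤ _ * (r + Δ) := mul_le_mul hb hz (abs_nonneg _) ((abs_nonneg _).trans hb)
              _ = _ := by rw [hc]; ring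
          · rw [indicator_of_notMem hz.1, indicator_of_notMem hz.2] at hb ⊢
            simp only [add_zero, mul_zero] at hb ⊢
            rw [le_antisymm hb (abs_nonneg _), zero_mul]
        refine (ENNReal.ofReal_le_ofReal key).trans ?_
        rw [mul_add]
        refine ENNReal.ofReal_add_le.trans (le_of_eq ?_)
        congr 1 <;> (simp only [indicator]; split_ifs <;> simp)
    _ = ENNReal.ofReal c * ENNReal.ofReal (2 * r) + ENNReal.ofReal c * ENNReal.ofReal (2 * r) := by
        rw [lintegral_add_left (measurable_const.indicator measurableSet_Icc),
          lintegral_indicator_const measurableSet_Icc,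
          lintegral_indicator_const measurableSet_Icc, Real.volume_Icc, Real.volume_Icc]
        ring_nf
    _ = ENNReal.ofReal (4 * M * (Δ / r) * (1 + Δ / r)) := by
        rw [← ENNReal.ofReal_mul hc0, ← ENNReal.ofReal_add (by positivity) (by positivity), hc]
        congr 1
        field_simp
        ring

/-- Since the kernel has zero mean, the Kruzkov flux may be replaced by its increment. -/
lemma enorm_integral_sign_mul_mollDefect_le {f w : ℝ → ℝ} {L : NNReal}
    (hf : LipschitzWith L f) (hw : Continuous w) (hρ : ContDiff ℝ 1 ρ)
    (hc : HasCompactSupport ρ) (hr : 0 < r) (a x : ℝ) :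
    ‖∫ y, Real.sign (a - w y) * (f a - f (w y)) * mollDefect ρ Δ r (x - y)‖ₑ
      ≤ L * ∫⁻ y, ‖w y - w x‖ₑ * ‖mollDefect ρ Δ r (x - y)‖ₑ := by
  set g : ℝ → ℝ := fun b => Real.sign (a - b) * (f a - f b) with hg
  set k : ℝ → ℝ := mollDefect ρ Δ r
  have hgL : LipschitzWith L g := LipschitzWith.of_dist_le_mul fun b c => by
    simpa [Real.dist_eq] using abs_sign_mul_sub_sub_le hf a b c
  have hkc : Continuous fun y => k (x - y) :=
    (continuous_mollDefect hρ).comp (continuous_const.sub continuous_id)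
  have hks : HasCompactSupport fun y => k (x - y) :=
    (hasCompactSupport_mollDefect (hρ.differentiable one_ne_zero) hc hr).comp_homeomorph
      (Homeomorph.subLeft x)
  have hi1 : Integrable fun y => g (w y) * k (x - y) :=
    ((hgL.continuous.comp hw).mul hkc).integrable_of_hasCompactSupport hks.mul_left
  have hi2 : Integrable fun y => g (w x) * k (x - y) :=
    (hkc.integrable_of_hasCompactSupport hks).const_mul _
  have h0 : ∫ y, g (w x) * k (x - y) = 0 := by
    rw [integral_const_mul, integral_sub_left_eq_self k, integral_mollDefect hρ hc hr, mul_zero]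
  have heq : ∫ y, g (w y) * k (x - y) = ∫ y, (g (w y) - g (w x)) * k (x - y) := by
    simp_rw [sub_mul]
    rw [integral_sub hi1 hi2, h0, sub_zero]
  change ‖∫ y, g (w y) * k (x - y)‖ₑ ≤ _
  rw [heq]
  refine (enorm_integral_le_lintegral_enorm _).trans ?_
  rw [← lintegral_const_mul']
  · refine lintegral_mono fun y => ?_
    rw [enorm_mul, ← mul_assoc]
    gcongr
    simpa [edist_eq_enorm_sub] using hgL (w y) (w x)
  · exact ENNReal.coe_ne_top

lemma moll_nonneg (hpos : ∀ x, 0 ≤ ρ x) (hr : 0 < r) (x : ℝ) : 0 ≤ moll ρ r x :=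
  div_nonneg (hpos _) hr.le

lemma integral_moll (hmass : ∫ x, ρ x = 1) (hr : 0 < r) : ∫ x, moll ρ r x = 1 := by
  unfold moll
  rw [integral_div, Measure.integral_comp_div ρ r, hmass, abs_of_pos hr, smul_eq_mul, mul_one,
    div_self hr.ne']

lemma integrable_moll (hρ : Continuous ρ) (hc : HasCompactSupport ρ) (hr : 0 < r) :
    Integrable (moll ρ r) := by
  refine Continuous.integrable_of_hasCompactSupport ?_ (hasCompactSupport_moll hc hr)
  unfold moll
  fun_prop

lemma Hmoll_mem_Icc (hρ : Continuous ρ) (hc : HasCompactSupport ρ) (hpos : ∀ x, 0 ≤ ρ x)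
    (hmass : ∫ x, ρ x = 1) (hr : 0 < r) (t : ℝ) : Hmoll ρ r t ∈ Icc (0 : ℝ) 1 := by
  refine ⟨setIntegral_nonneg measurableSet_Iic fun x _ => moll_nonneg hpos hr x, ?_⟩
  rw [← integral_moll hmass hr]
  exact setIntegral_le_integral (integrable_moll hρ hc hr)
    (Eventually.of_forall (moll_nonneg hpos hr))

lemma lintegral_enorm_moll_sub (hρ : Continuous ρ) (hc : HasCompactSupport ρ)
    (hpos : ∀ x, 0 ≤ ρ x) (hmass : ∫ x, ρ x = 1) (hr : 0 < r) (t : ℝ) :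
    ∫⁻ s, ‖moll ρ r (t - s)‖ₑ = 1 := by
  rw [lintegral_sub_left_eq_self fun s => ‖moll ρ r s‖ₑ,
    ← ofReal_integral_norm_eq_lintegral_enorm (integrable_moll hρ hc hr)]
  simp_rw [Real.norm_of_nonneg (moll_nonneg hpos hr _), integral_moll hmass hr]
  simp

lemma testphi_diff_add_deriv (hρ : Differentiable ℝ ρ) (r₀ α ν τ x t y s : ℝ) :
    (testphi ρ r r₀ α ν τ (x + Δ) t y s - testphi ρ r r₀ α ν τ x t y s) / Δ
        + deriv (fun y' => testphi ρ r r₀ α ν τ x t y' s) y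
      = (Hmoll ρ α (t - ν) - Hmoll ρ α (t - τ)) * moll ρ r₀ (t - s)
        * mollDefect ρ Δ r (x - y) := by
  have h := (((hasDerivAt_moll hρ r (x - y)).comp y ((hasDerivAt_id y).const_sub x)).const_mul
    (Hmoll ρ α (t - ν) - Hmoll ρ α (t - τ))).mul_const (moll ρ r₀ (t - s))
  have h' : deriv (fun y' => testphi ρ r r₀ α ν τ x t y' s) y = _ := h.deriv
  rw [h']
  unfold testphi mollDefect
  rw [show x + Δ - y = x - y + Δ by ring]
  ring

end Kernel

/-- Estimate `Beta2Est`: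
`|∬ sign(u_Δx − u)(f(u_Δx) − f(u))(D₊φ + ∂_yφ) dX| ≤ C (Δx/r)(1 + Δx/r)`,
with `C` depending only on `T`, `ρ`, the Lipschitz constant of `f` and
`|u⁰|_{BV}`, but not on `Δx, r, r₀, α`. -/
theorem stmt_14
    (T : ℝ) (hT : 0 < T)
    (ρ : ℝ → ℝ) (hρs : ContDiff ℝ (⊤ : ℕ∞) ρ) (hρsupp : tsupport ρ ⊆ Set.Icc (-1) 1)
    (hρeven : ∀ x, ρ (-x) = ρ x) (hρpos : ∀ x, 0 ≤ ρ x) (hρint : ∫ x, ρ x = 1)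
    (Lf : NNReal) (V : ℝ) :
    ∃ C : ℝ, 0 < C ∧
      ∀ (f A F₁ F₂ : ℝ → ℝ) (u0 : ℝ → ℝ) (uE : ℝ → ℝ → ℝ) (uG : ℝ → ℤ → ℝ)
        (Δx r r₀ α ν τ : ℝ),
        ContDiff ℝ 1 f → LipschitzWith Lf f →
        ContDiff ℝ 1 A → (∀ z, 0 < deriv A z) →
        ContDiff ℝ 1 F₁ → ContDiff ℝ 1 F₂ →
        (∀ z, 0 ≤ deriv F₁ z) → (∀ z, deriv F₂ z ≤ 0) →
        (∀ z, deriv F₁ z + deriv F₂ z = deriv f z) →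
        (∃ L : NNReal, LipschitzWith L F₁ ∧ LipschitzWith L F₂) →
        Integrable u0 → (∃ M, ∀ x, |u0 x| ≤ M) →
        eVariationOn u0 Set.univ ≤ ENNReal.ofReal V →
        0 < Δx → 0 < r →
        0 < ν → ν < τ → τ < T →
        0 < r₀ → r₀ < min ν (T - τ) →
        0 < α → α < min (ν - r₀) (T - τ - r₀) →
        -- the semi-discrete scheme
        (∀ t ∈ Set.Icc (0:ℝ) T, ∀ j : ℤ, HasDerivAt (fun t' => uG t' j)
          (-(((F₁ (uG t j) + F₂ (uG t (j+1))) - (F₁ (uG t (j-1)) + F₂ (uG t j))) / Δx)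
            + (A (uG t (j+1)) - 2 * A (uG t j) + A (uG t (j-1))) / Δx ^ 2) t) →
        (∀ j : ℤ, uG 0 j
          = (1 / Δx) * ∫ x in Set.Ioc (((j:ℝ) - 1/2) * Δx) (((j:ℝ) + 1/2) * Δx), u0 x) →
        (∀ t ∈ Set.Icc (0:ℝ) T,
          (∑' j : ℤ, (‖uG t (j+1) - uG t j‖₊ : ENNReal)) ≤ ENNReal.ofReal V) →
        -- the classical solution on Π_T
        ContDiffOn ℝ 2 (fun p : ℝ × ℝ => uE p.1 p.2) (Set.univ ×ˢ Set.Ioo 0 T) →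
        (∀ y, uE y 0 = u0 y) →
        (∀ y : ℝ, ∀ s ∈ Set.Ioo (0:ℝ) T,
          deriv (fun s' => uE y s') s + deriv (fun y' => f (uE y' s)) y
            = deriv (fun y' => deriv (fun y'' => A (uE y'' s)) y') y) →
        (∀ s ∈ Set.Icc (0:ℝ) T,
          eVariationOn (fun y => uE y s) Set.univ ≤ ENNReal.ofReal V) →
        |∫ t in Set.Ioo (0:ℝ) T, ∫ x : ℝ, ∫ s in Set.Ioo (0:ℝ) T, ∫ y : ℝ,
            Real.sign (uG t ⌈x / Δx - 1/2⌉ - uE y s)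
              * (f (uG t ⌈x / Δx - 1/2⌉) - f (uE y s))
              * ((testphi ρ r r₀ α ν τ (x + Δx) t y s - testphi ρ r r₀ α ν τ x t y s) / Δx
                  + deriv (fun y' => testphi ρ r r₀ α ν τ x t y' s) y)|
          ≤ C * (Δx / r) * (1 + Δx / r) := by
  have hc : HasCompactSupport ρ := isCompact_Icc.of_isClosed_subset (isClosed_tsupport ρ) hρsupp
  have hρ1 : ContDiff ℝ 1 ρ := hρs.of_le (by exact_mod_cast le_top)
  have hρd : Differentiable ℝ ρ := hρ1.differentiable one_ne_zero
  obtain ⟨M, hM⟩ := ContDiff.lipschitzWith_of_hasCompactSupport (𝕂 := ℝ) hc.deriv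
    (contDiff_infty_iff_deriv.1 hρs).2 (by simp)
  refine ⟨T * Lf * (4 * M) * max V 0 + 1, by positivity, ?_⟩
  intro f A F₁ F₂ u0 uE uG Δx r r₀ α ν τ _ hf _ _ _ _ _ _ _ _ _ _ _ hΔ hr _ _ _ hr₀ _ hα _
    _ _ _ hu _ _ hV
  set k : ℝ → ℝ := mollDefect ρ Δx r
  have hkm : Measurable k := (continuous_mollDefect hρ1).measurable
  set v : ℝ × ℝ → ℝ := (univ ×ˢ Ioo 0 T).indicator (fun p => uE p.1 p.2) with hv
  have hms : MeasurableSet ((univ : Set ℝ) ×ˢ Ioo (0 : ℝ) T) :=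
    MeasurableSet.univ.prod measurableSet_Ioo
  have hvm : Measurable v := by
    rw [hv, ← piecewise_eq_indicator]
    exact hu.continuousOn.measurable_piecewise continuousOn_const hms
  have hvu : ∀ s ∈ Ioo 0 T, ∀ y, v (y, s) = uE y s := fun s hs y =>
    
    indicator_of_mem (s := univ ×ˢ Ioo 0 T) (a := (y, s)) ⟨mem_univ _, hs⟩ _
  have hcont : ∀ s ∈ Ioo 0 T, Continuous fun y => uE y s := fun s hs =>
    hu.continuousOn.comp_continuous (by fun_prop : Continuous fun y : ℝ => (y, s))
      fun y => ⟨mem_univ _, hs⟩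
  set q : ℝ → ℝ → ENNReal := fun x s => ∫⁻ y, ‖v (y, s) - v (x, s)‖ₑ * ‖k (x - y)‖ₑ with hq
  have hqm : Measurable fun p : ℝ × ℝ => q p.1 p.2 := by
    refine Measurable.lintegral_prod_right' (f := fun p : (ℝ × ℝ) × ℝ =>
      ‖v (p.2, p.1.2) - v (p.1.1, p.1.2)‖ₑ * ‖k (p.1.1 - p.2)‖ₑ) ?_
    fun_prop
  set D : ℝ := 4 * M * (Δx / r) * (1 + Δx / r) with hD
  have hqi : ∀ s ∈ Ioo 0 T, ∫⁻ x, q x s ≤ ENNReal.ofReal D * ENNReal.ofReal V := fun s hs => by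
    refine (lintegral_lintegral_sub_mul_kernel_le (w := fun y => v (y, s)) (by fun_prop)
      hkm).trans (mul_le_mul' (lintegral_mollDefect_mul_abs_le hρd hM hρsupp hΔ hr) ?_)
    simp_rw [hvu s hs]
    exact hV s (Ioo_subset_Icc_self hs)
  have hpsi : ∀ t, ‖Hmoll ρ α (t - ν) - Hmoll ρ α (t - τ)‖ₑ ≤ 1 := fun t => by
    have h1 := Hmoll_mem_Icc hρ1.continuous hc hρpos hρint hα (t - ν)
    have h2 := Hmoll_mem_Icc hρ1.continuous hc hρpos hρint hα (t - τ)
    rw [Real.enorm_eq_ofReal_abs, ENNReal.ofReal_le_one]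
    exact abs_le.2 ⟨by linarith [h1.1, h2.2], by linarith [h1.2, h2.1]⟩
  simp_rw [testphi_diff_add_deriv hρd]
  have hinner : ∀ t x, ∀ s ∈ Ioo 0 T,
      ‖∫ y, Real.sign (uG t ⌈x / Δx - 1/2⌉ - uE y s)
          * (f (uG t ⌈x / Δx - 1/2⌉) - f (uE y s))
          * ((Hmoll ρ α (t - ν) - Hmoll ρ α (t - τ)) * moll ρ r₀ (t - s) * k (x - y))‖ₑ
        ≤ ‖moll ρ r₀ (t - s)‖ₑ * (Lf * q x s) := fun t x s hs => by
    simp_rw [mul_left_comm _ ((Hmoll ρ α (t - ν) - Hmoll ρ α (t - τ)) * moll ρ r₀ (t - s))]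
    rw [integral_const_mul, enorm_mul, enorm_mul]
    refine mul_le_mul' (mul_le_of_le_one_left' (hpsi t)) ?_
    simp only [hq, hvu s hs]
    exact enorm_integral_sign_mul_mollDefect_le hf (hcont s hs) hρ1 hc hr _ x
  have htime : ∀ t, ∫⁻ x, ∫⁻ s in Ioo 0 T, ‖moll ρ r₀ (t - s)‖ₑ * (Lf * q x s)
      ≤ Lf * (ENNReal.ofReal D * ENNReal.ofReal V) := fun t => by
    have hmm : Measurable fun s => ‖moll ρ r₀ (t - s)‖ₑ := by
      have := hρ1.continuous.measurable
      unfold moll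
      fun_prop
    rw [lintegral_lintegral_swap
      ((hmm.comp measurable_snd).mul (measurable_const.mul hqm)).aemeasurable]
    calc ∫⁻ s in Ioo 0 T, ∫⁻ x, ‖moll ρ r₀ (t - s)‖ₑ * (Lf * q x s)
        ≤ ∫⁻ s in Ioo 0 T,
            ‖moll ρ r₀ (t - s)‖ₑ * (Lf * (ENNReal.ofReal D * ENNReal.ofReal V)) := by
          refine setLIntegral_mono' measurableSet_Ioo fun s hs => ?_
          rw [lintegral_const_mul' _ _ enorm_ne_top, lintegral_const_mul' _ _ ENNReal.coe_ne_top]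
          gcongr
          exact hqi s hs
      _ ≤ ∫⁻ s, ‖moll ρ r₀ (t - s)‖ₑ * (Lf * (ENNReal.ofReal D * ENNReal.ofReal V)) :=
          setLIntegral_le_lintegral _ _
      _ = Lf * (ENNReal.ofReal D * ENNReal.ofReal V) := by
          rw [lintegral_mul_const _ hmm,
            lintegral_enorm_moll_sub hρ1.continuous hc hρpos hρint hr₀, one_mul]
  have hD0 : 0 ≤ D := by positivity
  have hVm : ENNReal.ofReal V = ENNReal.ofReal (max V 0) := by simp [ENNReal.ofReal_max]
  suffices h : ENNReal.ofReal |_| ≤ ENNReal.ofReal (T * (Lf * (D * max V 0))) by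
    have h2 := (ENNReal.ofReal_le_ofReal_iff (by positivity)).1 h
    refine h2.trans ?_
    have : 0 ≤ Δx / r * (1 + Δx / r) := by positivity
    rw [hD]
    linarith
  rw [← Real.enorm_eq_ofReal_abs]
  refine (enorm_integral_le_lintegral_enorm _).trans ?_
  calc _ ≤ ∫⁻ t in Ioo 0 T, Lf * (ENNReal.ofReal D * ENNReal.ofReal V) := by
        refine lintegral_mono fun t => ?_
        refine (enorm_integral_le_lintegral_enorm _).trans (le_trans ?_ (htime t))
        refine lintegral_mono fun x => (enorm_integral_le_lintegral_enorm _).trans ?_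
        exact setLIntegral_mono' measurableSet_Ioo fun s hs => hinner t x s hs
    _ = ENNReal.ofReal (T * (Lf * (D * max V 0))) := by
        rw [setLIntegral_const, Real.volume_Ioo, sub_zero, hVm, mul_comm,
          ENNReal.ofReal_mul hT.le, ENNReal.ofReal_mul Lf.coe_nonneg, ENNReal.ofReal_mul hD0,
          ENNReal.ofReal_coe_nnreal]
end

section
/- With u_Δx the piecewise constant semi-discrete approximation, u the classical solution, and φ the test function described in the context, one has |∬_{Π_T²} |A(u_Δx) − A(u)| (D_−D_+φ + (D_+ + D_−)∂_y φ + ∂_y² φ) dX| ≤ C (Δx²/r³)(1 + Δx/r), where C depends only on T, ρ and |A(u⁰)|_{BV(ℝ)}, but not on Δx, r, r₀, α. -/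
open MeasureTheory Set Filter

/-- The combined second-order difference/differential stencil acting on `P`, with `P₁`, `P₂` playing
the roles of the first two derivatives of `P`. -/
noncomputable def stencil (P P₁ P₂ : ℝ → ℝ) (k z : ℝ) : ℝ :=
  (P (z + k) - 2 * P z + P (z - k)) / k ^ 2 - (P₁ (z + k) - P₁ (z - k)) / k + P₂ z

theorem hasDerivAt_shift {P P₁ : ℝ → ℝ} (h : ∀ z, HasDerivAt P (P₁ z) z) (k z : ℝ) :
    HasDerivAt (fun z => P (z + k)) (P₁ (z + k)) z :=
  (h (z + k)).comp_add_const z k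

theorem hasDerivAt_stencil {P P₁ P₂ P₃ : ℝ → ℝ} (h₀ : ∀ z, HasDerivAt P (P₁ z) z)
    (h₁ : ∀ z, HasDerivAt P₁ (P₂ z) z) (h₂ : ∀ z, HasDerivAt P₂ (P₃ z) z) (k z : ℝ) :
    HasDerivAt (stencil P P₁ P₂ k) (stencil P₁ P₂ P₃ k z) z := by
  unfold stencil
  have e := fun (z : ℝ) => sub_eq_add_neg z k
  simp only [e]
  exact (((((hasDerivAt_shift h₀ k z).sub ((h₀ z).const_mul 2)).add
    (hasDerivAt_shift h₀ (-k) z)).div_const _).sub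
    (((hasDerivAt_shift h₁ k z).sub (hasDerivAt_shift h₁ (-k) z)).div_const _)).add (h₂ z)

theorem stencil_eq_zero {P P₁ P₂ : ℝ → ℝ} {R₀ k z : ℝ} (hk : 0 ≤ k)
    (hP : ∃ a b, (∀ x, R₀ < x → P x = a) ∧ (∀ x, x < -R₀ → P x = b))
    (hP₁ : ∀ x, R₀ < |x| → P₁ x = 0) (hP₂ : ∀ x, R₀ < |x| → P₂ x = 0)
    (hz : R₀ + k < |z|) : stencil P P₁ P₂ k z = 0 := by
  obtain ⟨a, b, ha, hb⟩ := hP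
  unfold stencil
  rcases lt_abs.1 hz with h | h
  · rw [ha (z + k) (by linarith), ha z (by linarith), ha (z - k) (by linarith),
      hP₁ (z + k) (lt_abs.2 (by left; linarith)), hP₁ (z - k) (lt_abs.2 (by left; linarith)),
      hP₂ z (lt_abs.2 (by left; linarith))]
    ring
  · rw [hb (z + k) (by linarith), hb z (by linarith), hb (z - k) (by linarith),
      hP₁ (z + k) (lt_abs.2 (by right; linarith)), hP₁ (z - k) (lt_abs.2 (by right; linarith)),
      hP₂ z (lt_abs.2 (by right; linarith))]
    ring

theorem abs_sub_le_of_hasDerivAt {g g' : ℝ → ℝ} {C a b : ℝ} (hg : ∀ x, HasDerivAt g (g' x) x)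
    (hab : a ≤ b) (hC : ∀ x ∈ Icc a b, |g' x| ≤ C) : |g b - g a| ≤ C * (b - a) := by
  have := (convex_Icc a b).norm_image_sub_le_of_norm_hasDerivWithin_le
    (fun x _ => (hg x).hasDerivWithinAt) hC (left_mem_Icc.2 hab) (right_mem_Icc.2 hab)
  rwa [Real.norm_eq_abs, Real.norm_eq_abs, abs_of_nonneg (sub_nonneg.2 hab)] at this

theorem abs_second_difference_le {Q Q₁ Q₂ : ℝ → ℝ} {M : ℝ} (h₀ : ∀ z, HasDerivAt Q (Q₁ z) z)
    (h₁ : ∀ z, HasDerivAt Q₁ (Q₂ z) z) (hM : ∀ z, |Q₂ z| ≤ M) {k : ℝ} (hk : 0 ≤ k) (z : ℝ) :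
    |Q (z + k) - 2 * Q z + Q (z - k)| ≤ 2 * M * k ^ 2 := by
  have hd : ∀ j, HasDerivAt (fun j => Q (z + j) + Q (z - j)) (Q₁ (z + j) - Q₁ (z - j)) j := by
    intro j
    exact (((h₀ (z + j)).comp_const_add z j).add ((h₀ (z - j)).comp_const_sub z j)).congr_deriv
      (by ring)
  have := abs_sub_le_of_hasDerivAt (C := M * (2 * k)) hd hk (by
    intro j hj
    have h := abs_sub_le_of_hasDerivAt (C := M) (a := z - j) (b := z + j) h₁ (by linarith [hj.1])
      (fun x _ => hM x)
    have hM0 := (abs_nonneg _).trans (hM 0)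
    nlinarith [hj.1, hj.2])
  simp only [add_zero, sub_zero] at this
  rw [show Q (z + k) - 2 * Q z + Q (z - k) = Q (z + k) + Q (z - k) - (Q z + Q z) by ring]
  linarith

theorem abs_stencil_le {P P₁ P₂ P₃ P₄ : ℝ → ℝ} {M : ℝ} (h₀ : ∀ z, HasDerivAt P (P₁ z) z)
    (h₁ : ∀ z, HasDerivAt P₁ (P₂ z) z) (h₂ : ∀ z, HasDerivAt P₂ (P₃ z) z)
    (h₃ : ∀ z, HasDerivAt P₃ (P₄ z) z) (hM : ∀ z, |P₄ z| ≤ M) {k : ℝ} (hk : 0 < k) (z : ℝ) :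
    |stencil P P₁ P₂ k z| ≤ 2 * M * k ^ 2 := by
  have hd : ∀ j, HasDerivAt (fun j => P (z + j) + P (z - j) - j * (P₁ (z + j) - P₁ (z - j))
      + j ^ 2 * P₂ z) (-(j * (P₂ (z + j) - 2 * P₂ z + P₂ (z - j)))) j := by
    intro j
    have a := fun (Q Q' : ℝ → ℝ) (h : ∀ z, HasDerivAt Q (Q' z) z) => (h (z + j)).comp_const_add z j
    have b := fun (Q Q' : ℝ → ℝ) (h : ∀ z, HasDerivAt Q (Q' z) z) => (h (z - j)).comp_const_sub z j
    exact ((((a _ _ h₀).add (b _ _ h₀)).sub ((hasDerivAt_id' j).mul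
      ((a _ _ h₁).sub (b _ _ h₁)))).add ((hasDerivAt_pow 2 j).mul_const (P₂ z))).congr_deriv
      (by simp; ring)
  have hM0 := (abs_nonneg _).trans (hM 0)
  have := abs_sub_le_of_hasDerivAt (C := 2 * M * k ^ 3) hd hk.le (by
    intro j hj
    rw [abs_neg, abs_mul, abs_of_nonneg hj.1]
    calc j * |P₂ (z + j) - 2 * P₂ z + P₂ (z - j)| ≤ j * (2 * M * j ^ 2) :=
          mul_le_mul_of_nonneg_left (abs_second_difference_le h₂ h₃ hM hj.1 z) hj.1
      _ = 2 * M * j ^ 3 := by ring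
      _ ≤ 2 * M * k ^ 3 := by
          have := pow_le_pow_left₀ hj.1 hj.2 3
          gcongr)
  have e : stencil P P₁ P₂ k z = (P (z + k) + P (z - k) - k * (P₁ (z + k) - P₁ (z - k))
      + k ^ 2 * P₂ z - (P (z + 0) + P (z - 0) - 0 * (P₁ (z + 0) - P₁ (z - 0))
      + 0 ^ 2 * P₂ z)) / k ^ 2 := by
    unfold stencil
    field_simp
    simp
    ring
  rw [e, abs_div, abs_of_pos (pow_pos hk 2), div_le_iff₀ (pow_pos hk 2)]
  linarith

theorem abs_deriv_le_of_abs_sub_le {g v : ℝ → ℝ} {y : ℝ} (hv : DifferentiableAt ℝ v y)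
    (h : ∀ x, |g x - g y| ≤ |v x - v y|) : |deriv g y| ≤ |deriv v y| := by
  by_cases hg : DifferentiableAt ℝ g y
  · refine le_of_tendsto_of_tendsto (hasDerivAt_iff_tendsto_slope.1 hg.hasDerivAt).abs
      (hasDerivAt_iff_tendsto_slope.1 hv.hasDerivAt).abs (Eventually.of_forall fun x => ?_)
    simp only [slope_def_field, abs_div]
    exact div_le_div_of_nonneg_right (h x) (abs_nonneg _)
  · simp [deriv_zero_of_not_differentiableAt hg]

theorem lintegral_enorm_deriv_le_eVariationOn (b : ℝ → ℝ) :
    ∫⁻ y, ‖deriv b y‖ₑ ≤ eVariationOn b univ := by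
  by_cases hfin : eVariationOn b univ = ⊤
  · simp [hfin]
  have hbv : BoundedVariationOn b univ := hfin
  have hloc := hbv.locallyBoundedVariationOn
  set v := variationOnFromTo b univ 0 with hvdef
  have hmono : Monotone v := monotoneOn_univ.1 (variationOnFromTo.monotoneOn hloc (mem_univ 0))
  have hle : ∀ x y, |b x - b y| ≤ |v x - v y| := by
    intro x y
    rcases le_total y x with h | h
    · exact (variationOnFromTo.abs_sub_le_sub_of_le hloc (mem_univ 0) (mem_univ y) (mem_univ x)
        h).trans (le_abs_self _)
    · rw [abs_sub_comm, abs_sub_comm (v x)]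
      exact (variationOnFromTo.abs_sub_le_sub_of_le hloc (mem_univ 0) (mem_univ x) (mem_univ y)
        h).trans (le_abs_self _)
  have hae : ∀ᵐ y, ‖deriv b y‖ₑ ≤ ‖deriv v y‖ₑ := by
    filter_upwards [hmono.ae_differentiableAt] with y hy
    exact enorm_le_iff_norm_le.2 (abs_deriv_le_of_abs_sub_le hy fun x => hle x y)
  refine (lintegral_mono_ae hae).trans ?_
  have hcov : AECover volume atTop (fun n : ℕ => Icc (-(n : ℝ)) n) :=
    aecover_Icc (tendsto_neg_atTop_atBot.comp tendsto_natCast_atTop_atTop)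
      tendsto_natCast_atTop_atTop
  refine le_of_tendsto (hcov.lintegral_tendsto_of_countably_generated
    (measurable_deriv v).enorm.aemeasurable) (Eventually.of_forall fun n => ?_)
  have hn : -(n : ℝ) ≤ n := by linarith [n.cast_nonneg (α := ℝ)]
  have hmon := hmono.monotoneOn (uIcc (-(n : ℝ)) n)
  have hint := (intervalIntegrable_iff_integrableOn_Icc_of_le hn).1 hmon.intervalIntegrable_deriv
  have hmem := hmon.intervalIntegral_deriv_mem_uIcc
  rw [uIcc_of_le (sub_nonneg.2 (hmono hn))] at hmem
  rw [← ofReal_integral_norm_eq_lintegral_enorm hint]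
  refine ENNReal.ofReal_le_of_le_toReal ?_
  have h1 : ∫ y in Icc (-(n : ℝ)) n, ‖deriv v y‖ = ∫ y in (-(n : ℝ))..n, deriv v y := by
    rw [integral_Icc_eq_integral_Ioc, ← intervalIntegral.integral_of_le hn]
    exact intervalIntegral.integral_congr fun y _ => by
      simp [abs_of_nonneg hmono.deriv_nonneg]
  rw [h1]
  refine hmem.2.trans ?_
  rw [hvdef, variationOnFromTo.sub_right hloc (mem_univ _) (mem_univ _) (mem_univ _)]
  exact (le_abs_self _).trans (variationOnFromTo.abs_le_eVariationOn hbv)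

theorem enorm_integral_abs_sub_mul_le {b K K' : ℝ → ℝ} (hb : ContDiff ℝ 1 b)
    (hK : ∀ z, HasDerivAt K (K' z) z) (hK' : Continuous K') {R₀ : ℝ}
    (h₀ : ∀ z, R₀ < |z| → K z = 0) (h₁ : ∀ z, R₀ < |z| → K' z = 0) (a x : ℝ) :
    ‖∫ y, |a - b y| * K' (x - y)‖ₑ ≤ ∫⁻ y, ‖deriv b y‖ₑ * ‖K (x - y)‖ₑ := by
  set R := |R₀| + 1 with hR
  have hRR : R₀ < R := by linarith [le_abs_self R₀]
  have hR0 : 0 < R := by positivity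
  set G : ℝ → ℝ := fun y => -K (x - y) with hG
  have hGd : ∀ y, HasDerivAt G (K' (x - y)) y := fun y =>
    ((hK (x - y)).comp_const_sub x y).neg.congr_deriv (by simp)
  have hGd' : deriv G = fun y => K' (x - y) := funext fun y => (hGd y).deriv
  have hG1 : ContDiff ℝ 1 G := contDiff_one_iff_deriv.2
    ⟨fun y => (hGd y).differentiableAt, by rw [hGd']; fun_prop⟩
  have hsupp : Function.support (fun y => |a - b y| * K' (x - y)) ⊆ Ioc (x - R) (x + R) := by
    intro y hy
    by_contra hcon
    refine hy ?_
    have : R₀ < |x - y| := by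
      refine hRR.trans_le (le_abs.2 ?_)
      by_contra! hc
      exact hcon ⟨by linarith, by linarith⟩
    simp [h₁ _ this]
  have hfac : AbsolutelyContinuousOnInterval (fun y => |a - b y|) (x - R) (x + R) := by
    obtain ⟨C, hC⟩ := (contDiff_const.sub hb : ContDiff ℝ 1 fun y => a - b y).contDiffOn
      |>.exists_lipschitzOnWith (by decide) (convex_uIcc (x - R) (x + R)) isCompact_uIcc
    exact ((lipschitzWith_one_norm (E := ℝ)).comp_lipschitzOnWith hC).absolutelyContinuousOnInterval
  have hibp := hfac.integral_mul_deriv_eq_deriv_mul (g := G)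
    hG1.contDiffOn.absolutelyContinuousOnInterval
  have e1 : G (x + R) = 0 := by
    simp only [hG, neg_eq_zero]
    exact h₀ _ (by rw [show x - (x + R) = -R by ring, abs_neg, abs_of_pos hR0]; exact hRR)
  have e2 : G (x - R) = 0 := by
    simp only [hG, neg_eq_zero]
    exact h₀ _ (by rw [show x - (x - R) = R by ring, abs_of_pos hR0]; exact hRR)
  rw [e1, e2, hGd'] at hibp
  rw [← intervalIntegral.integral_eq_integral_of_support_subset hsupp, hibp,
    intervalIntegral.integral_of_le (by linarith)]
  simp only [mul_zero, sub_zero, zero_sub, enorm_neg]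
  refine (enorm_integral_le_lintegral_enorm _).trans ((lintegral_mono fun y => ?_).trans
    (setLIntegral_le_lintegral _ _))
  rw [enorm_mul, hG, enorm_neg]
  gcongr
  refine enorm_le_iff_norm_le.2 (abs_deriv_le_of_abs_sub_le
    (hb.differentiable one_ne_zero y) fun z => ?_)
  refine (abs_abs_sub_abs_le _ _).trans ?_
  rw [show a - b z - (a - b y) = -(b z - b y) by ring, abs_neg]

theorem lintegral_lintegral_convolution_le {D : ℝ → ℝ → ENNReal} {c k : ℝ → ENNReal}
    (hD : Measurable fun p : ℝ × ℝ => D p.1 p.2) (hc : Measurable c) (hk : Measurable k)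
    {S : Set ℝ} {V : ENNReal} (hS : MeasurableSet S) (hV : ∀ s ∈ S, ∫⁻ y, D y s ≤ V) :
    ∫⁻ x, ∫⁻ s in S, c s * ∫⁻ y, D y s * k (x - y) ≤ (∫⁻ s, c s) * V * ∫⁻ z, k z := by
  have hm : Measurable fun q : (ℝ × ℝ) × ℝ => D q.2 q.1.2 * k (q.1.1 - q.2) :=
    (hD.comp (measurable_snd.prodMk (measurable_snd.comp measurable_fst))).mul
      (hk.comp ((measurable_fst.comp measurable_fst).sub measurable_snd))
  have hm2 : Measurable fun p : ℝ × ℝ => c p.2 * ∫⁻ y, D y p.2 * k (p.1 - y) :=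
    (hc.comp measurable_snd).mul hm.lintegral_prod_right'
  rw [lintegral_lintegral_swap hm2.aemeasurable]
  calc ∫⁻ s in S, ∫⁻ x, c s * ∫⁻ y, D y s * k (x - y)
      ≤ ∫⁻ s in S, c s * (V * ∫⁻ z, k z) := by
        refine setLIntegral_mono_ae' hS (Eventually.of_forall fun s hs => ?_)
        have hDs : Measurable fun y => D y s := hD.comp (measurable_id.prodMk measurable_const)
        have hmx : Measurable fun x => ∫⁻ y, D y s * k (x - y) :=
          hm.lintegral_prod_right'.comp (measurable_id.prodMk measurable_const)
        rw [lintegral_const_mul _ hmx, lintegral_lintegral_swap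
          (((hDs.comp measurable_snd).mul (hk.comp (measurable_fst.sub measurable_snd))).aemeasurable)]
        gcongr
        calc ∫⁻ y, ∫⁻ x, D y s * k (x - y) = ∫⁻ y, D y s * ∫⁻ z, k z := by
              refine lintegral_congr fun y => ?_
              rw [lintegral_const_mul (f := fun x => k (x - y)) _ (hk.comp (measurable_id.sub_const y)),
                lintegral_sub_right_eq_self k y]
          _ = (∫⁻ y, D y s) * ∫⁻ z, k z := lintegral_mul_const _ hDs
          _ ≤ V * ∫⁻ z, k z := by gcongr; exact hV s hs
    _ ≤ ∫⁻ s, c s * (V * ∫⁻ z, k z) := setLIntegral_le_lintegral _ _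
    _ = (∫⁻ s, c s) * V * ∫⁻ z, k z := by rw [lintegral_mul_const _ hc, mul_assoc]

theorem exists_measurable_enorm_deriv {B : ℝ → ℝ → ℝ} {S : Set ℝ} (hS : IsOpen S)
    (hB : ContDiffOn ℝ 1 (fun p : ℝ × ℝ => B p.1 p.2) (univ ×ˢ S)) :
    ∃ D : ℝ → ℝ → ENNReal, (Measurable fun p : ℝ × ℝ => D p.1 p.2) ∧
      ∀ s ∈ S, ∀ y, D y s = ‖deriv (fun y => B y s) y‖ₑ := by
  have hO : IsOpen ((univ : Set ℝ) ×ˢ S) := isOpen_univ.prod hS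
  have hc : ContinuousOn (fun p : ℝ × ℝ => ‖fderiv ℝ (fun p : ℝ × ℝ => B p.1 p.2) p (1, 0)‖ₑ)
      (univ ×ˢ S) :=
    ((hB.continuousOn_fderiv_of_isOpen hO le_rfl).clm_apply continuousOn_const).enorm
  classical
  refine ⟨fun y s => (univ ×ˢ S).piecewise
    (fun p : ℝ × ℝ => ‖fderiv ℝ (fun p : ℝ × ℝ => B p.1 p.2) p (1, 0)‖ₑ) 0 (y, s),
    hc.measurable_piecewise continuousOn_const hO.measurableSet, fun s hs y => ?_⟩
  refine (piecewise_eq_of_mem _ _ _ (show (y, s) ∈ (univ : Set ℝ) ×ˢ S from ⟨trivial, hs⟩)).trans ?_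
  have h1 := ((hB.differentiableOn one_ne_zero).differentiableAt
    (hO.mem_nhds (show (y, s) ∈ (univ : Set ℝ) ×ˢ S from ⟨trivial, hs⟩))).hasFDerivAt
  have h2 := h1.comp_hasDerivAt y ((hasDerivAt_id y).prodMk (hasDerivAt_const y s))
  exact congrArg _ h2.deriv.symm

theorem moll_nonneg_s15 {ρ : ℝ → ℝ} (hρ : ∀ x, 0 ≤ ρ x) {a : ℝ} (ha : 0 < a) (x : ℝ) :
    0 ≤ moll ρ a x :=
  div_nonneg (hρ _) ha.le

theorem integrable_moll_s15 {ρ : ℝ → ℝ} (hρ : Integrable ρ) {a : ℝ} (ha : 0 < a) :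
    Integrable (moll ρ a) :=
  (hρ.comp_div ha.ne').div_const a

theorem integral_moll_s15 {ρ : ℝ → ℝ} (hρ : ∫ x, ρ x = 1) {a : ℝ} (ha : 0 < a) :
    ∫ x, moll ρ a x = 1 := by
  simp only [moll]
  rw [integral_div, Measure.integral_comp_div, hρ, abs_of_pos ha, smul_eq_mul, mul_one,
    div_self ha.ne']

theorem lintegral_enorm_moll_sub_s15 {ρ : ℝ → ℝ} (hρ : ∀ x, 0 ≤ ρ x) (hi : Integrable ρ)
    (h1 : ∫ x, ρ x = 1) {a : ℝ} (ha : 0 < a) (t : ℝ) :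
    ∫⁻ s, ‖moll ρ a (t - s)‖ₑ = 1 := by
  rw [lintegral_sub_left_eq_self (fun s => ‖moll ρ a s‖ₑ) t,
    ← ofReal_integral_norm_eq_lintegral_enorm (integrable_moll_s15 hi ha)]
  simp [abs_of_nonneg (moll_nonneg_s15 hρ ha _), integral_moll_s15 h1 ha]

theorem Hmoll_mem_Icc_s15 {ρ : ℝ → ℝ} (hρ : ∀ x, 0 ≤ ρ x) (hi : Integrable ρ)
    (h1 : ∫ x, ρ x = 1) {a : ℝ} (ha : 0 < a) (t : ℝ) : Hmoll ρ a t ∈ Icc 0 1 := by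
  refine ⟨setIntegral_nonneg measurableSet_Iic fun x _ => moll_nonneg_s15 hρ ha x, ?_⟩
  rw [← integral_moll_s15 h1 ha]
  exact setIntegral_le_integral (integrable_moll_s15 hi ha) (Eventually.of_forall (moll_nonneg_s15 hρ ha))

theorem hasDerivAt_comp_sub_div {P P₁ : ℝ → ℝ} (h : ∀ z, HasDerivAt P (P₁ z) z) (r x y : ℝ) :
    HasDerivAt (fun y => P ((x - y) / r)) (-(P₁ ((x - y) / r) / r)) y :=
  ((h ((x - y) / r)).comp y (((hasDerivAt_id' y).const_sub x).div_const r)).congr_deriv (by ring)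

theorem deriv_testphi {ρ ρ₁ : ℝ → ℝ} (h : ∀ z, HasDerivAt ρ (ρ₁ z) z) (r r₀ α ν τ x t y s : ℝ) :
    deriv (fun y => testphi ρ r r₀ α ν τ x t y s) y =
      (Hmoll ρ α (t - ν) - Hmoll ρ α (t - τ)) * (-(ρ₁ ((x - y) / r) / r) / r)
        * moll ρ r₀ (t - s) :=
  ((((hasDerivAt_comp_sub_div h r x y).div_const r).const_mul _).mul_const _).deriv

theorem deriv_deriv_testphi {ρ ρ₁ ρ₂ : ℝ → ℝ} (h : ∀ z, HasDerivAt ρ (ρ₁ z) z)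
    (h₁ : ∀ z, HasDerivAt ρ₁ (ρ₂ z) z) (r r₀ α ν τ x t y s : ℝ) :
    deriv (fun y => deriv (fun y => testphi ρ r r₀ α ν τ x t y s) y) y =
      (Hmoll ρ α (t - ν) - Hmoll ρ α (t - τ)) * (-(-(ρ₂ ((x - y) / r) / r) / r) / r)
        * moll ρ r₀ (t - s) := by
  simp only [deriv_testphi h]
  exact (((((hasDerivAt_comp_sub_div h₁ r x y).div_const r).fun_neg.div_const r).const_mul
    _).mul_const _).deriv

theorem testphi_stencil_eq {ρ ρ₁ ρ₂ : ℝ → ℝ} (h : ∀ z, HasDerivAt ρ (ρ₁ z) z)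
    (h₁ : ∀ z, HasDerivAt ρ₁ (ρ₂ z) z) {r Δx : ℝ} (hr : 0 < r) (hΔ : 0 < Δx)
    (r₀ α ν τ x t y s : ℝ) :
    (testphi ρ r r₀ α ν τ (x + Δx) t y s - 2 * testphi ρ r r₀ α ν τ x t y s
          + testphi ρ r r₀ α ν τ (x - Δx) t y s) / Δx ^ 2
        + (deriv (fun y' => testphi ρ r r₀ α ν τ (x + Δx) t y' s) y
          - deriv (fun y' => testphi ρ r r₀ α ν τ (x - Δx) t y' s) y) / Δx
        + deriv (fun y' => deriv (fun y'' => testphi ρ r r₀ α ν τ x t y'' s) y') y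
      = (Hmoll ρ α (t - ν) - Hmoll ρ α (t - τ)) * moll ρ r₀ (t - s)
        * (stencil ρ ρ₁ ρ₂ (Δx / r) ((x - y) / r) / r ^ 3) := by
  rw [deriv_deriv_testphi h h₁, deriv_testphi h, deriv_testphi h]
  simp only [testphi, stencil, moll]
  rw [show (x + Δx - y) / r = (x - y) / r + Δx / r by ring,
    show (x - Δx - y) / r = (x - y) / r - Δx / r by ring]
  field_simp
  ring

theorem lintegral_enorm_le_of_bounded_support {K : ℝ → ℝ} {c a : ℝ} (hc : ∀ z, |K z| ≤ c)
    (ha : ∀ z, a < |z| → K z = 0) : ∫⁻ z, ‖K z‖ₑ ≤ ENNReal.ofReal (c * (2 * a)) := by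
  have hc0 := (abs_nonneg _).trans (hc 0)
  calc ∫⁻ z, ‖K z‖ₑ ≤ ∫⁻ z, (Icc (-a) a).indicator (fun _ => ENNReal.ofReal c) z := by
        refine lintegral_mono fun z => ?_
        by_cases hz : z ∈ Icc (-a) a
        · rw [indicator_of_mem hz, Real.enorm_eq_ofReal_abs]
          exact ENNReal.ofReal_le_ofReal (hc z)
        · have : a < |z| := by
            rw [lt_abs]
            by_contra! h
            exact hz ⟨by linarith, h.1⟩
          simp [ha z this]
    _ = ENNReal.ofReal (c * (2 * a)) := by
        rw [lintegral_indicator_const measurableSet_Icc, Real.volume_Icc,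
          ← ENNReal.ofReal_mul hc0]
        congr 2
        ring

theorem deriv_eq_zero_of_eq_zero {P : ℝ → ℝ} {a : ℝ} (h : ∀ x, a < |x| → P x = 0) {x : ℝ}
    (hx : a < |x|) : deriv P x = 0 := by
  have : P =ᶠ[nhds x] fun _ => 0 := by
    filter_upwards [(isOpen_lt continuous_const continuous_abs).mem_nhds hx] with y hy
    exact h y hy
  rw [this.deriv_eq, deriv_const]

theorem exists_const_of_primitive {P : ℝ → ℝ} (hP : Continuous P) {a : ℝ}
    (h : ∀ x, a < |x| → P x = 0) :
    ∃ p q, (∀ x, a < x → ∫ y in (0 : ℝ)..x, P y = p) ∧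
      (∀ x, x < -a → ∫ y in (0 : ℝ)..x, P y = q) := by
  refine ⟨∫ y in (0 : ℝ)..a, P y, ∫ y in (0 : ℝ)..(-a), P y, fun x hx => ?_, fun x hx => ?_⟩
  · rw [← intervalIntegral.integral_add_adjacent_intervals (hP.intervalIntegrable 0 a)
      (hP.intervalIntegrable a x), add_eq_left]
    refine intervalIntegral.integral_zero_ae (Eventually.of_forall fun y hy => h y ?_)
    rw [uIoc_of_le hx.le] at hy
    exact lt_abs.2 (Or.inl hy.1)
  · rw [← intervalIntegral.integral_add_adjacent_intervals (hP.intervalIntegrable 0 (-a))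
      (hP.intervalIntegrable (-a) x), add_eq_left, intervalIntegral.integral_symm, neg_eq_zero,
      intervalIntegral.integral_of_le hx.le, integral_Ioc_eq_integral_Ioo]
    refine setIntegral_eq_zero_of_forall_eq_zero fun y hy => h y (lt_abs.2 (Or.inr ?_))
    linarith [hy.2]

/-- Estimate `DoubleDerEst`:
`|∬ |A(u_Δx) − A(u)| (D₋D₊φ + (D₊+D₋)∂_yφ + ∂_y²φ) dX| ≤ C (Δx²/r³)(1 + Δx/r)`,
with `C` depending only on `T`, `ρ` and `|A(u⁰)|_{BV}`, but not on
`Δx, r, r₀, α`. -/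
theorem stmt_15
    (T : ℝ) (hT : 0 < T)
    (ρ : ℝ → ℝ) (hρs : ContDiff ℝ (⊤ : ℕ∞) ρ) (hρsupp : tsupport ρ ⊆ Set.Icc (-1) 1)
    (hρeven : ∀ x, ρ (-x) = ρ x) (hρpos : ∀ x, 0 ≤ ρ x) (hρint : ∫ x, ρ x = 1)
    (VA : ℝ) :
    ∃ C : ℝ, 0 < C ∧
      ∀ (f A F₁ F₂ : ℝ → ℝ) (u0 : ℝ → ℝ) (uE : ℝ → ℝ → ℝ) (uG : ℝ → ℤ → ℝ)
        (Δx r r₀ α ν τ : ℝ),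
        ContDiff ℝ 1 f → (∃ L : NNReal, LipschitzWith L f) →
        ContDiff ℝ 1 A → (∀ z, 0 < deriv A z) →
        ContDiff ℝ 1 F₁ → ContDiff ℝ 1 F₂ →
        (∀ z, 0 ≤ deriv F₁ z) → (∀ z, deriv F₂ z ≤ 0) →
        (∀ z, deriv F₁ z + deriv F₂ z = deriv f z) →
        (∃ L : NNReal, LipschitzWith L F₁ ∧ LipschitzWith L F₂) →
        Integrable u0 → (∃ M, ∀ x, |u0 x| ≤ M) → BoundedVariationOn u0 Set.univ →
        eVariationOn (fun x => A (u0 x)) Set.univ ≤ ENNReal.ofReal VA →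
        0 < Δx → 0 < r →
        0 < ν → ν < τ → τ < T →
        0 < r₀ → r₀ < min ν (T - τ) →
        0 < α → α < min (ν - r₀) (T - τ - r₀) →
        -- the semi-discrete scheme
        (∀ t ∈ Set.Icc (0:ℝ) T, ∀ j : ℤ, HasDerivAt (fun t' => uG t' j)
          (-(((F₁ (uG t j) + F₂ (uG t (j+1))) - (F₁ (uG t (j-1)) + F₂ (uG t j))) / Δx)
            + (A (uG t (j+1)) - 2 * A (uG t j) + A (uG t (j-1))) / Δx ^ 2) t) →
        (∀ j : ℤ, uG 0 j
          = (1 / Δx) * ∫ x in Set.Ioc (((j:ℝ) - 1/2) * Δx) (((j:ℝ) + 1/2) * Δx), u0 x) →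
        (∀ t ∈ Set.Icc (0:ℝ) T,
          (∑' j : ℤ, (‖A (uG t (j+1)) - A (uG t j)‖₊ : ENNReal)) ≤ ENNReal.ofReal VA) →
        -- the classical solution on Π_T
        ContDiffOn ℝ 2 (fun p : ℝ × ℝ => uE p.1 p.2) (Set.univ ×ˢ Set.Ioo 0 T) →
        (∀ y, uE y 0 = u0 y) →
        (∀ y : ℝ, ∀ s ∈ Set.Ioo (0:ℝ) T,
          deriv (fun s' => uE y s') s + deriv (fun y' => f (uE y' s)) y
            = deriv (fun y' => deriv (fun y'' => A (uE y'' s)) y') y) →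
        (∀ s ∈ Set.Icc (0:ℝ) T,
          eVariationOn (fun y => A (uE y s)) Set.univ ≤ ENNReal.ofReal VA) →
        |∫ t in Set.Ioo (0:ℝ) T, ∫ x : ℝ, ∫ s in Set.Ioo (0:ℝ) T, ∫ y : ℝ,
            |A (uG t ⌈x / Δx - 1/2⌉) - A (uE y s)|
              * ((testphi ρ r r₀ α ν τ (x + Δx) t y s - 2 * testphi ρ r r₀ α ν τ x t y s
                    + testphi ρ r r₀ α ν τ (x - Δx) t y s) / Δx ^ 2
                + (deriv (fun y' => testphi ρ r r₀ α ν τ (x + Δx) t y' s) y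
                    - deriv (fun y' => testphi ρ r r₀ α ν τ (x - Δx) t y' s) y) / Δx
                + deriv (fun y' => deriv (fun y'' => testphi ρ r r₀ α ν τ x t y'' s) y') y)|
          ≤ C * (Δx ^ 2 / r ^ 3) * (1 + Δx / r) := by
  have hsm : ∀ {P : ℝ → ℝ}, ContDiff ℝ (⊤ : ℕ∞) P → ContDiff ℝ (⊤ : ℕ∞) (deriv P) ∧
      ∀ z, HasDerivAt P (deriv P z) z := fun {P} hP =>
    ⟨(contDiff_infty_iff_deriv.1 hP).2,
      fun z => ((contDiff_infty_iff_deriv.1 hP).1 z).hasDerivAt⟩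
  set ρ₁ := deriv ρ
  set ρ₂ := deriv ρ₁
  set ρ₃ := deriv ρ₂
  obtain ⟨hs₁, hd₀⟩ := hsm hρs
  obtain ⟨hs₂, hd₁⟩ := hsm hs₁
  obtain ⟨hs₃, hd₂⟩ := hsm hs₂
  have hz : ∀ x, 1 < |x| → ρ x = 0 := fun x hx =>
    image_eq_zero_of_notMem_tsupport fun hmem =>
      absurd (abs_le.2 ⟨(hρsupp hmem).1, (hρsupp hmem).2⟩) (not_le.2 hx)
  have hz₁ : ∀ x, 1 < |x| → ρ₁ x = 0 := fun x hx => deriv_eq_zero_of_eq_zero hz hx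
  have hz₂ : ∀ x, 1 < |x| → ρ₂ x = 0 := fun x hx => deriv_eq_zero_of_eq_zero hz₁ hx
  have hcs : HasCompactSupport ρ := HasCompactSupport.of_support_subset_isCompact isCompact_Icc
    ((subset_tsupport ρ).trans hρsupp)
  have hρi : Integrable ρ := hρs.continuous.integrable_of_hasCompactSupport hcs
  obtain ⟨M, hM⟩ := hcs.deriv.deriv.deriv.exists_bound_of_continuous hs₃.continuous
  have hM' : ∀ x, |ρ₃ x| ≤ M := hM
  have hM0 : 0 ≤ M := (abs_nonneg _).trans (hM' 0)
  set R : ℝ → ℝ := fun x => ∫ y in (0 : ℝ)..x, ρ y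
  have hdR : ∀ z, HasDerivAt R (ρ z) z := fun z => hρs.continuous.integral_hasStrictDerivAt 0 z
    |>.hasDerivAt
  refine ⟨max VA 0 * (4 * M) * T + 1, by positivity, ?_⟩
  intro f A F₁ F₂ u0 uE uG Δx r r₀ α ν τ _ _ hA _ _ _ _ _ _ _ _ _ _ _ hΔ hr _ _ _ hr₀ _ hα _
    _ _ _ huE _ _ hV
  have hkpos : 0 < Δx / r := div_pos hΔ hr
  set K : ℝ → ℝ := fun z => stencil R ρ ρ₁ (Δx / r) (z / r) / r ^ 2 with hKdef
  set K' : ℝ → ℝ := fun z => stencil ρ ρ₁ ρ₂ (Δx / r) (z / r) / r ^ 3 with hK'def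
  have hKd : ∀ z, HasDerivAt K (K' z) z := fun z =>
    (((hasDerivAt_stencil hdR hd₀ hd₁ (Δx / r) (z / r)).comp z
      ((hasDerivAt_id' z).div_const r)).div_const (r ^ 2)).congr_deriv (by
        simp only [hK'def]; field_simp; rfl)
  have hKc : Continuous K := continuous_iff_continuousAt.2 fun z => (hKd z).continuousAt
  have hK'c : Continuous K' := by
    have h₀ := hρs.continuous
    have h₁ := hs₁.continuous
    have h₂ := hs₂.continuous
    simp only [hK'def, stencil]
    fun_prop
  have hsc : ∀ z, r + Δx < |z| → 1 + Δx / r < |z / r| := fun z hzr => by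
    rw [abs_div, abs_of_pos hr, lt_div_iff₀ hr]
    field_simp
    linarith
  have hK0 : ∀ z, r + Δx < |z| → K z = 0 := fun z hzr => by
    simp only [hKdef]
    rw [stencil_eq_zero hkpos.le (exists_const_of_primitive hρs.continuous hz) hz hz₁ (hsc z hzr),
      zero_div]
  have hK'0 : ∀ z, r + Δx < |z| → K' z = 0 := fun z hzr => by
    simp only [hK'def]
    rw [stencil_eq_zero hkpos.le ⟨0, 0, fun x hx => hz x (lt_abs.2 (Or.inl hx)),
      fun x hx => hz x (lt_abs.2 (Or.inr (by linarith)))⟩ hz₁ hz₂ (hsc z hzr), zero_div]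
  have hKb : ∀ z, |K z| ≤ 2 * M * (Δx / r) ^ 2 / r ^ 2 := fun z => by
    simp only [hKdef, abs_div, abs_of_pos (pow_pos hr 2)]
    gcongr
    exact abs_stencil_le hdR hd₀ hd₁ hd₂ hM' hkpos _
  set q := Δx ^ 2 / r ^ 3 * (1 + Δx / r) with hq
  have hq0 : 0 ≤ q := by positivity
  have hKint : ∫⁻ z, ‖K z‖ₑ ≤ ENNReal.ofReal (4 * M * q) := by
    refine (lintegral_enorm_le_of_bounded_support hKb hK0).trans_eq (congrArg _ ?_)
    rw [hq]
    field_simp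
    ring
  have hB : ContDiffOn ℝ 1 (fun p : ℝ × ℝ => A (uE p.1 p.2)) (univ ×ˢ Ioo 0 T) :=
    hA.comp_contDiffOn (huE.of_le one_le_two)
  have hb : ∀ s ∈ Ioo 0 T, ContDiff ℝ 1 fun y => A (uE y s) := fun s hs =>
    contDiffOn_univ.1 (hB.comp (contDiff_id.prodMk contDiff_const).contDiffOn
      fun y _ => ⟨trivial, hs⟩)
  obtain ⟨D, hD, hDeq⟩ := exists_measurable_enorm_deriv (B := fun y s => A (uE y s)) isOpen_Ioo hB
  have hDV : ∀ s ∈ Ioo 0 T, ∫⁻ y, D y s ≤ ENNReal.ofReal VA := fun s hs => by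
    simp only [hDeq s hs]
    exact (lintegral_enorm_deriv_le_eVariationOn _).trans (hV s (Ioo_subset_Icc_self hs))
  simp only [testphi_stencil_eq hd₀ hd₁ hr hΔ]
  set ψ : ℝ → ℝ := fun t => Hmoll ρ α (t - ν) - Hmoll ρ α (t - τ)
  have hψ : ∀ t, ‖ψ t‖ₑ ≤ 1 := fun t => by
    have h1 := Hmoll_mem_Icc_s15 hρpos hρi hρint hα (t - ν)
    have h2 := Hmoll_mem_Icc_s15 hρpos hρi hρint hα (t - τ)
    rw [Real.enorm_eq_ofReal_abs, ENNReal.ofReal_le_one]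
    exact abs_le.2 ⟨by linarith [h1.1, h2.2], by linarith [h1.2, h2.1]⟩
  have hinner : ∀ t a x, ∀ s ∈ Ioo 0 T,
      ‖∫ y, |a - A (uE y s)| * (ψ t * moll ρ r₀ (t - s) * K' (x - y))‖ₑ
        ≤ ‖moll ρ r₀ (t - s)‖ₑ * ∫⁻ y, D y s * ‖K (x - y)‖ₑ := by
    intro t a x s hs
    simp only [mul_left_comm _ (ψ t * moll ρ r₀ (t - s))]
    rw [integral_const_mul, enorm_mul, enorm_mul]
    simp only [hDeq s hs]
    calc _ ≤ 1 * ‖moll ρ r₀ (t - s)‖ₑ * _ := mul_le_mul' (mul_le_mul' (hψ t) le_rfl)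
          (enorm_integral_abs_sub_mul_le (hb s hs) hKd hK'c hK0 hK'0 a x)
      _ = _ := by rw [one_mul]
  have hmc : Continuous (moll ρ r₀) := by
    have := hρs.continuous
    unfold moll
    fun_prop
  have hspace : ∀ t (a : ℝ → ℝ),
      ‖∫ x, ∫ s in Ioo 0 T, ∫ y,
        |a x - A (uE y s)| * (ψ t * moll ρ r₀ (t - s) * K' (x - y))‖ₑ
        ≤ ENNReal.ofReal VA * ENNReal.ofReal (4 * M * q) := by
    intro t a
    calc _ ≤ ∫⁻ x, ∫⁻ s in Ioo 0 T, ‖∫ y,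
          |a x - A (uE y s)| * (ψ t * moll ρ r₀ (t - s) * K' (x - y))‖ₑ :=
          (enorm_integral_le_lintegral_enorm _).trans
            (lintegral_mono fun x => enorm_integral_le_lintegral_enorm _)
      _ ≤ ∫⁻ x, ∫⁻ s in Ioo 0 T, ‖moll ρ r₀ (t - s)‖ₑ * ∫⁻ y, D y s * ‖K (x - y)‖ₑ :=
          lintegral_mono fun x => setLIntegral_mono_ae' measurableSet_Ioo
            (Eventually.of_forall fun s hs => hinner t (a x) x s hs)
      _ ≤ (∫⁻ s, ‖moll ρ r₀ (t - s)‖ₑ) * ENNReal.ofReal VA * ∫⁻ z, ‖K z‖ₑ :=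
          lintegral_lintegral_convolution_le hD
            (hmc.comp (continuous_const.sub continuous_id)).enorm.measurable
            hKc.enorm.measurable measurableSet_Ioo hDV
      _ ≤ ENNReal.ofReal VA * ENNReal.ofReal (4 * M * q) := by
          rw [lintegral_enorm_moll_sub_s15 hρpos hρi hρint hr₀, one_mul]
          gcongr
  have hfinal := (enorm_integral_le_lintegral_enorm (μ := volume.restrict (Ioo 0 T)) _).trans
    (lintegral_mono fun t => hspace t fun x => A (uG t ⌈x / Δx - 1 / 2⌉))
  have hVA : ENNReal.ofReal VA = ENNReal.ofReal (max VA 0) := by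
    rcases le_total VA 0 with h | h <;> simp [h, ENNReal.ofReal_of_nonpos]
  rw [setLIntegral_const, Real.volume_Ioo, sub_zero, hVA] at hfinal
  rw [← ENNReal.ofReal_mul (le_max_right _ _), ← ENNReal.ofReal_mul (by positivity),
    Real.enorm_eq_ofReal_abs, ENNReal.ofReal_le_ofReal_iff (by positivity)] at hfinal
  refine hfinal.trans ?_
  rw [mul_assoc _ (Δx ^ 2 / r ^ 3), ← hq]
  linarith
end
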